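/- arXiv:2406.01164 — 2 statements merged into one kernel-verified Lean document; each statement's English description precedes it below -/
import Mathlib

section
/- Let L > 0, c > 0, λ ≥ 0, D > 0 be real numbers, and let ρ, m : ℝ × ℝ → ℝ be continuously differentiable functions with ρ(x,t) > 0 for all x ∈ [0,L] and all t. Suppose that for all x ∈ [0,L] and all t the ISO2b equations hold: ∂ₜρ(x,t) + ∂ₓm(x,t) = 0 and ∂ₜm(x,t) + ∂ₓ(c²ρ(x,t)) = −(λ/(2D))·m(x,t)·|m(x,t)/ρ(x,t)|. Define the Hamiltonian H(t) = ∫₀ᴸ ( c²·ρ(x,t)²/2 + m(x,t)²/2 ) dx. Then for every t, H'(t) = c²ρ(0,t)·m(0,t) − c²ρ(L,t)·m(L,t) − ∫₀ᴸ (λ/(2D))·|m(x,t)/ρ(x,t)|·m(x,t)² dx. -/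
open intervalIntegral

/-- Chain rule along the first coordinate line. -/
lemma HasFDerivAt.hasDerivAt_prodMk_left {f : ℝ × ℝ → ℝ} {x t : ℝ} {f' : ℝ × ℝ →L[ℝ] ℝ}
    (hf : HasFDerivAt f f' (x, t)) : HasDerivAt (fun ξ => f (ξ, t)) (f' (1, 0)) x :=
  hf.comp_hasDerivAt x ((hasDerivAt_id x).prodMk (hasDerivAt_const x t))

/-- Chain rule along the second coordinate line. -/
lemma HasFDerivAt.hasDerivAt_prodMk_right {f : ℝ × ℝ → ℝ} {x t : ℝ} {f' : ℝ × ℝ →L[ℝ] ℝ}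
    (hf : HasFDerivAt f f' (x, t)) : HasDerivAt (fun τ => f (x, τ)) (f' (0, 1)) t :=
  hf.comp_hasDerivAt t ((hasDerivAt_const t x).prodMk (hasDerivAt_id t))

/-- Differentiation under the integral sign for a `C¹` integrand over a compact interval. -/
lemma ContDiff.hasDerivAt_intervalIntegral {f : ℝ × ℝ → ℝ} (hf : ContDiff ℝ 1 f) (a b t : ℝ) :
    HasDerivAt (fun τ => ∫ x in a..b, f (x, τ)) (∫ x in a..b, fderiv ℝ f (x, t) (0, 1)) t := by
  have hcont : Continuous fun p => fderiv ℝ f p (0, 1) :=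
    (hf.continuous_fderiv one_ne_zero).clm_apply continuous_const
  obtain ⟨C, hC⟩ := (isCompact_uIcc.prod (isCompact_closedBall t 1)).exists_bound_of_continuousOn
    (s := Set.uIcc a b ×ˢ Metric.closedBall t 1) hcont.continuousOn
  have hslice (τ : ℝ) : Continuous fun x => f (x, τ) := hf.continuous.comp (by fun_prop)
  refine (hasDerivAt_integral_of_dominated_loc_of_deriv_le (bound := fun _ => C)
    (F := fun τ x => f (x, τ)) (F' := fun τ x => fderiv ℝ f (x, τ) (0, 1))
    (Metric.closedBall_mem_nhds t one_pos)
    (.of_forall fun τ => (hslice τ).aestronglyMeasurable)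
    ((hslice t).intervalIntegrable a b)
    (hcont.comp (by fun_prop : Continuous fun x : ℝ => (x, t))).aestronglyMeasurable
    (.of_forall fun x hx τ hτ => hC (x, τ) ⟨Set.uIoc_subset_uIcc hx, hτ⟩)
    intervalIntegrable_const
    (.of_forall fun x _ τ _ => ?_)).2
  exact (hf.differentiable one_ne_zero (x, τ)).hasFDerivAt.hasDerivAt_prodMk_right

/-- Energy balance for the ISO2b pipe model: if `ρ`, `m` are `C¹`
solutions of `∂ₜρ + ∂ₓm = 0`,
`∂ₜm + ∂ₓ(c²ρ) = -(λ/(2D)) m |m/ρ|` on a pipe `[0, L]`, then the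
Hamiltonian `H(t) = ∫₀ᴸ (c²ρ²/2 + m²/2) dx` satisfies
`H'(t) = c²ρ(0,t)m(0,t) - c²ρ(L,t)m(L,t) - ∫₀ᴸ (λ/(2D))|m/ρ| m² dx`. -/
theorem iso2b_pipe_energy_balance
    (L c lam D : ℝ) (hL : 0 < L) (hc : 0 < c) (hlam : 0 ≤ lam) (hD : 0 < D)
    (ρ m : ℝ × ℝ → ℝ) (hρ : ContDiff ℝ 1 ρ) (hm : ContDiff ℝ 1 m)
    (hρpos : ∀ x ∈ Set.Icc (0 : ℝ) L, ∀ t : ℝ, 0 < ρ (x, t))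
    (hmass : ∀ x ∈ Set.Icc (0 : ℝ) L, ∀ t : ℝ,
      deriv (fun τ => ρ (x, τ)) t + deriv (fun ξ => m (ξ, t)) x = 0)
    (hmom : ∀ x ∈ Set.Icc (0 : ℝ) L, ∀ t : ℝ,
      deriv (fun τ => m (x, τ)) t + deriv (fun ξ => c ^ 2 * ρ (ξ, t)) x =
        -(lam / (2 * D)) * m (x, t) * |m (x, t) / ρ (x, t)|)
    (H : ℝ → ℝ)
    (hH : ∀ t : ℝ, H t =
      ∫ x in (0 : ℝ)..L, (c ^ 2 * ρ (x, t) ^ 2 / 2 + m (x, t) ^ 2 / 2)) :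
    ∀ t : ℝ, HasDerivAt H
      (c ^ 2 * ρ (0, t) * m (0, t) - c ^ 2 * ρ (L, t) * m (L, t)
        - ∫ x in (0 : ℝ)..L,
            lam / (2 * D) * |m (x, t) / ρ (x, t)| * m (x, t) ^ 2) t := by
  intro t
  have hf : ContDiff ℝ 1 fun p : ℝ × ℝ => c ^ 2 * ρ p ^ 2 / 2 + m p ^ 2 / 2 := by fun_prop
  have hg : ContDiff ℝ 1 fun p : ℝ × ℝ => c ^ 2 * ρ p * m p := by fun_prop
  set f := fun p : ℝ × ℝ => c ^ 2 * ρ p ^ 2 / 2 + m p ^ 2 / 2 with hf_def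
  set g := fun p : ℝ × ℝ => c ^ 2 * ρ p * m p with hg_def
  have hslice : Continuous fun x : ℝ => (x, t) := by fun_prop
  have hft : Continuous fun x => fderiv ℝ f (x, t) (0, 1) :=
    ((hf.continuous_fderiv one_ne_zero).comp hslice).clm_apply continuous_const
  have hgx : Continuous fun x => fderiv ℝ g (x, t) (1, 0) :=
    ((hg.continuous_fderiv one_ne_zero).comp hslice).clm_apply continuous_const
  have hflux : ∫ x in (0 : ℝ)..L, fderiv ℝ g (x, t) (1, 0) = g (L, t) - g (0, t) :=
    integral_eq_sub_of_hasDerivAt (f := fun x => g (x, t))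
      (fun x _ => (hg.differentiable one_ne_zero (x, t)).hasFDerivAt.hasDerivAt_prodMk_left)
      (hgx.intervalIntegrable 0 L)
  have hlocal : ∫ x in (0 : ℝ)..L, (fderiv ℝ f (x, t) (0, 1) + fderiv ℝ g (x, t) (1, 0)) =
      ∫ x in (0 : ℝ)..L, -(lam / (2 * D) * |m (x, t) / ρ (x, t)| * m (x, t) ^ 2) := by
    refine integral_congr fun x hx => ?_
    rw [Set.uIcc_of_le hL.le] at hx
    have hρ' := (hρ.differentiable one_ne_zero (x, t)).hasFDerivAt
    have hm' := (hm.differentiable one_ne_zero (x, t)).hasFDerivAt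
    have hρx := hρ'.hasDerivAt_prodMk_left
    have hρt := hρ'.hasDerivAt_prodMk_right
    have hmx := hm'.hasDerivAt_prodMk_left
    have hmt := hm'.hasDerivAt_prodMk_right
    have hft_eq := (hf.differentiable one_ne_zero (x, t)).hasFDerivAt.hasDerivAt_prodMk_right.unique
      ((((hρt.pow 2).const_mul (c ^ 2)).div_const 2).add ((hmt.pow 2).div_const 2))
    have hgx_eq := (hg.differentiable one_ne_zero (x, t)).hasFDerivAt.hasDerivAt_prodMk_left.unique
      ((hρx.const_mul (c ^ 2)).mul hmx)
    have hmass' := hmass x hx t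
    have hmom' := hmom x hx t
    rw [hρt.deriv, hmx.deriv] at hmass'
    rw [hmt.deriv, (hρx.const_mul (c ^ 2)).deriv] at hmom'
    simp only [hft_eq, hgx_eq]
    push_cast
    linear_combination c ^ 2 * ρ (x, t) * hmass' + m (x, t) * hmom'
  rw [integral_add (hft.intervalIntegrable 0 L) (hgx.intervalIntegrable 0 L), hflux,
    intervalIntegral.integral_neg] at hlocal
  rw [funext hH]
  refine (hf.hasDerivAt_intervalIntegral 0 L t).congr_deriv ?_
  simp only [hg_def] at hlocal
  linear_combination hlocal
end

section
/- Let L₁, L₂ > 0, c > 0, λ ≥ 0, D > 0 and c̃ > 0 be real numbers. For i = 1,2 let ρᵢ, mᵢ : ℝ × ℝ → ℝ be continuously differentiable with ρᵢ(x,t) > 0 on [0,Lᵢ], satisfying the ISO2b equations ∂ₜρᵢ + ∂ₓmᵢ = 0 and ∂ₜmᵢ + ∂ₓ(c²ρᵢ) = −(λ/(2D))·mᵢ·|mᵢ/ρᵢ| for all x ∈ [0,Lᵢ] and all t. Assume the FC/AM compressor coupling conditions hold for all t: c²ρ₂(0,t) = c̃·c²ρ₁(L₁,t) and m₁(L₁,t)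 = m₂(0,t). Let H(t) = ∫₀^{L₁} (c²ρ₁²/2 + m₁²/2) dx + ∫₀^{L₂} (c²ρ₂²/2 + m₂²/2) dx. Then for every t, H'(t) = c²ρ₁(0,t)·m₁(0,t) − c²ρ₂(L₂,t)·m₂(L₂,t) + (c̃ − 1)·c²ρ₁(L₁,t)·m₂(0,t) − ∫₀^{L₁} (λ/(2D))·|m₁/ρ₁|·m₁² dx − ∫₀^{L₂} (λ/(2D))·|m₂/ρ₂|·m₂² dx. -/
open intervalIntegral

/-- Differentiation under the integral sign for a `C¹` integrand on a compact interval. -/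
theorem ContDiff.hasDerivAt_intervalIntegral_snd {F : ℝ × ℝ → ℝ} (hF : ContDiff ℝ 1 F)
    (a b t : ℝ) :
    HasDerivAt (fun τ => ∫ x in a..b, F (x, τ)) (∫ x in a..b, fderiv ℝ F (x, t) (0, 1)) t := by
  have hF' : Continuous fun p : ℝ × ℝ => fderiv ℝ F p (0, 1) :=
    (hF.continuous_fderiv one_ne_zero).clm_apply continuous_const
  obtain ⟨C, hC⟩ := (isCompact_uIcc.prod (isCompact_closedBall t 1)).exists_bound_of_continuousOn
    (s := Set.uIcc a b ×ˢ Metric.closedBall t 1) hF'.continuousOn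
  have hslice : ∀ τ, Continuous fun x => F (x, τ) := fun τ =>
    hF.continuous.comp (by fun_prop)
  refine (intervalIntegral.hasDerivAt_integral_of_dominated_loc_of_deriv_le
    (F := fun τ x => F (x, τ)) (F' := fun τ x => fderiv ℝ F (x, τ) (0, 1)) (bound := fun _ => C)
    (Metric.closedBall_mem_nhds t one_pos)
    (Filter.Eventually.of_forall fun τ => (hslice τ).aestronglyMeasurable)
    ((hslice t).intervalIntegrable a b)
    (hF'.comp (by fun_prop : Continuous fun x : ℝ => (x, t))).aestronglyMeasurable
    (Filter.Eventually.of_forall fun x hx τ hτ => hC (x, τ) ⟨Set.uIoc_subset_uIcc hx, hτ⟩)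
    intervalIntegrable_const
    (Filter.Eventually.of_forall fun x _ τ _ => ?_)).2
  exact ((hF.differentiable one_ne_zero) (x, τ)).hasFDerivAt.comp_hasDerivAt τ
    ((hasDerivAt_const τ x).prodMk (hasDerivAt_id τ))

/-- Energy balance of a single pipe, with friction force `-k * m * |m / ρ|`. -/
theorem hasDerivAt_pipe_energy {L c k : ℝ} (hL : 0 ≤ L) {ρ m : ℝ × ℝ → ℝ}
    (hρ : ContDiff ℝ 1 ρ) (hm : ContDiff ℝ 1 m) (t : ℝ)
    (hmass : ∀ x ∈ Set.Icc (0 : ℝ) L,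
      deriv (fun τ => ρ (x, τ)) t + deriv (fun ξ => m (ξ, t)) x = 0)
    (hmom : ∀ x ∈ Set.Icc (0 : ℝ) L,
      deriv (fun τ => m (x, τ)) t + deriv (fun ξ => c ^ 2 * ρ (ξ, t)) x =
        -k * m (x, t) * |m (x, t) / ρ (x, t)|) :
    HasDerivAt (fun τ => ∫ x in (0 : ℝ)..L, (c ^ 2 * ρ (x, τ) ^ 2 / 2 + m (x, τ) ^ 2 / 2))
      (c ^ 2 * ρ (0, t) * m (0, t) - c ^ 2 * ρ (L, t) * m (L, t)
        - ∫ x in (0 : ℝ)..L, k * |m (x, t) / ρ (x, t)| * m (x, t) ^ 2) t := by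
  have hE : ContDiff ℝ 1 fun p => c ^ 2 * ρ p ^ 2 / 2 + m p ^ 2 / 2 := by fun_prop
  have hflux : ContDiff ℝ 1 fun x => c ^ 2 * ρ (x, t) * m (x, t) := by fun_prop
  have hE' : Continuous fun x : ℝ =>
      fderiv ℝ (fun p => c ^ 2 * ρ p ^ 2 / 2 + m p ^ 2 / 2) (x, t) (0, 1) :=
    ((hE.continuous_fderiv one_ne_zero).comp (by fun_prop)).clm_apply continuous_const
  have hflux' : Continuous (deriv fun x => c ^ 2 * ρ (x, t) * m (x, t)) :=
    hflux.continuous_deriv le_rfl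
  have hlocal : Set.EqOn (fun x => k * |m (x, t) / ρ (x, t)| * m (x, t) ^ 2)
      (fun x => -fderiv ℝ (fun p => c ^ 2 * ρ p ^ 2 / 2 + m p ^ 2 / 2) (x, t) (0, 1)
        - deriv (fun x => c ^ 2 * ρ (x, t) * m (x, t)) x) (Set.uIcc 0 L) := by
    intro x hx
    rw [Set.uIcc_of_le hL] at hx
    have hρt : DifferentiableAt ℝ (fun τ => ρ (x, τ)) t :=
      (hρ.differentiable one_ne_zero).comp (by fun_prop) t
    have hmt : DifferentiableAt ℝ (fun τ => m (x, τ)) t :=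
      (hm.differentiable one_ne_zero).comp (by fun_prop) t
    have hρx : DifferentiableAt ℝ (fun ξ => ρ (ξ, t)) x :=
      (hρ.differentiable one_ne_zero).comp (by fun_prop) x
    have hmx : DifferentiableAt ℝ (fun ξ => m (ξ, t)) x :=
      (hm.differentiable one_ne_zero).comp (by fun_prop) x
    have hEt : fderiv ℝ (fun p => c ^ 2 * ρ p ^ 2 / 2 + m p ^ 2 / 2) (x, t) (0, 1) =
        c ^ 2 * ρ (x, t) * deriv (fun τ => ρ (x, τ)) t
          + m (x, t) * deriv (fun τ => m (x, τ)) t := by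
      have hchain := ((hE.differentiable one_ne_zero) (x, t)).hasFDerivAt.comp_hasDerivAt t
        ((hasDerivAt_const t x).prodMk (hasDerivAt_id t))
      refine hchain.unique (((((hρt.hasDerivAt.pow 2).const_mul (c ^ 2)).div_const 2).add
        ((hmt.hasDerivAt.pow 2).div_const 2)).congr_deriv ?_)
      norm_num
      ring
    have hGx : deriv (fun ξ => c ^ 2 * ρ (ξ, t) * m (ξ, t)) x =
        c ^ 2 * deriv (fun ξ => ρ (ξ, t)) x * m (x, t)
          + c ^ 2 * ρ (x, t) * deriv (fun ξ => m (ξ, t)) x :=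
      ((hρx.hasDerivAt.const_mul (c ^ 2)).mul hmx.hasDerivAt).deriv
    have hmom' := hmom x hx
    rw [deriv_const_mul _ hρx] at hmom'
    simp only [hEt, hGx]
    linear_combination (c ^ 2 * ρ (x, t)) * hmass x hx + m (x, t) * hmom'
  refine (hE.hasDerivAt_intervalIntegral_snd 0 L t).congr_deriv ?_
  rw [intervalIntegral.integral_congr hlocal,
    intervalIntegral.integral_sub (hE'.fun_neg.intervalIntegrable 0 L)
      (hflux'.intervalIntegrable 0 L),
    intervalIntegral.integral_neg,
    intervalIntegral.integral_deriv_eq_sub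
      (fun x _ => (hflux.differentiable one_ne_zero) x) (hflux'.intervalIntegrable 0 L)]
  ring

/-- Energy balance for two ISO2b pipes coupled by a compressor in
framework FC (prescribed compression ratio `ct`) under assumption AM
(constant momentum across the compressor). -/
theorem fc_am_two_pipe_energy_balance
    (L₁ L₂ c lam D : ℝ) (hL₁ : 0 < L₁) (hL₂ : 0 < L₂) (hc : 0 < c)
    (hlam : 0 ≤ lam) (hD : 0 < D) (ct : ℝ) (hct : 0 < ct)
    (ρ₁ m₁ ρ₂ m₂ : ℝ × ℝ → ℝ)
    (hρ₁ : ContDiff ℝ 1 ρ₁) (hm₁ : ContDiff ℝ 1 m₁)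
    (hρ₂ : ContDiff ℝ 1 ρ₂) (hm₂ : ContDiff ℝ 1 m₂)
    (hρ₁pos : ∀ x ∈ Set.Icc (0 : ℝ) L₁, ∀ t : ℝ, 0 < ρ₁ (x, t))
    (hρ₂pos : ∀ x ∈ Set.Icc (0 : ℝ) L₂, ∀ t : ℝ, 0 < ρ₂ (x, t))
    (hmass₁ : ∀ x ∈ Set.Icc (0 : ℝ) L₁, ∀ t : ℝ,
      deriv (fun τ => ρ₁ (x, τ)) t + deriv (fun ξ => m₁ (ξ, t)) x = 0)
    (hmom₁ : ∀ x ∈ Set.Icc (0 : ℝ) L₁, ∀ t : ℝ,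
      deriv (fun τ => m₁ (x, τ)) t + deriv (fun ξ => c ^ 2 * ρ₁ (ξ, t)) x =
        -(lam / (2 * D)) * m₁ (x, t) * |m₁ (x, t) / ρ₁ (x, t)|)
    (hmass₂ : ∀ x ∈ Set.Icc (0 : ℝ) L₂, ∀ t : ℝ,
      deriv (fun τ => ρ₂ (x, τ)) t + deriv (fun ξ => m₂ (ξ, t)) x = 0)
    (hmom₂ : ∀ x ∈ Set.Icc (0 : ℝ) L₂, ∀ t : ℝ,
      deriv (fun τ => m₂ (x, τ)) t + deriv (fun ξ => c ^ 2 * ρ₂ (ξ, t)) x =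
        -(lam / (2 * D)) * m₂ (x, t) * |m₂ (x, t) / ρ₂ (x, t)|)
    (hpressure : ∀ t : ℝ, c ^ 2 * ρ₂ (0, t) = ct * (c ^ 2 * ρ₁ (L₁, t)))
    (hmomentum : ∀ t : ℝ, m₁ (L₁, t) = m₂ (0, t))
    (H : ℝ → ℝ)
    (hH : ∀ t : ℝ, H t =
      (∫ x in (0 : ℝ)..L₁, (c ^ 2 * ρ₁ (x, t) ^ 2 / 2 + m₁ (x, t) ^ 2 / 2)) +
      ∫ x in (0 : ℝ)..L₂, (c ^ 2 * ρ₂ (x, t) ^ 2 / 2 + m₂ (x, t) ^ 2 / 2)) :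
    ∀ t : ℝ, HasDerivAt H
      (c ^ 2 * ρ₁ (0, t) * m₁ (0, t) - c ^ 2 * ρ₂ (L₂, t) * m₂ (L₂, t)
        + (ct - 1) * (c ^ 2 * ρ₁ (L₁, t)) * m₂ (0, t)
        - (∫ x in (0 : ℝ)..L₁,
            lam / (2 * D) * |m₁ (x, t) / ρ₁ (x, t)| * m₁ (x, t) ^ 2)
        - ∫ x in (0 : ℝ)..L₂,
            lam / (2 * D) * |m₂ (x, t) / ρ₂ (x, t)| * m₂ (x, t) ^ 2) t := by
  intro t
  have h₁ := hasDerivAt_pipe_energy hL₁.le hρ₁ hm₁ t (hmass₁ · · t) (hmom₁ · · t)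
  have h₂ := hasDerivAt_pipe_energy hL₂.le hρ₂ hm₂ t (hmass₂ · · t) (hmom₂ · · t)
  rw [funext hH]
  refine (h₁.add h₂).congr_deriv ?_
  rw [hpressure, hmomentum]
  ring
end
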